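/- arXiv:2009.10406 — 5 statements merged into one kernel-verified Lean document; each statement's English description precedes it below -/
import Mathlib

section
/- Let E be a real normed vector space, (Ω, 𝓕, ℙ) a probability space, and m̄ : [0,∞) × Ω → E a map such that: for every u ≥ 0 the function ω ↦ sup_{t ∈ [0,u]} ‖m̄(t,ω)‖ (with values in [0,∞]) is measurable; for every k ∈ ℕ the random variable S_k(ω) := sup_{t ∈ [k,k+1]} ‖m̄(t,ω)‖ is measurable and has the same distribution as S₀; and 𝔼[S₀^γ] < ∞ for some γ > 0. Let α > 2/γ and T > 0. Then ℙ({ω : sup_{t ∈ [0, T/ε²]} ‖m̄(t,ω)‖ > ε^{−α}}) → 0 as ε → 0⁺. -/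
open MeasureTheory Filter
open scoped ENNReal

/-- Markov's inequality for the `γ`-th power: the tail of `X` above `ε ^ (-α)` is at most
`ε ^ (α * γ)` times the moment of order `γ`. -/
theorem measure_ofReal_rpow_neg_lt_le {Ω : Type*} [MeasurableSpace Ω] (μ : Measure Ω)
    {X : Ω → ℝ≥0∞} (hX : Measurable X) {γ : ℝ} (hγ : 0 < γ) (α : ℝ) {ε : ℝ} (hε : 0 < ε) :
    μ {ω | ENNReal.ofReal (ε ^ (-α)) < X ω} ≤
      ENNReal.ofReal (ε ^ (α * γ)) * ∫⁻ ω, X ω ^ γ ∂μ := by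
  have hmarkov := mul_meas_ge_le_lintegral (μ := μ) (hX.pow_const γ)
    (ENNReal.ofReal (ε ^ (-α * γ)))
  have hsub : {ω | ENNReal.ofReal (ε ^ (-α)) < X ω} ⊆
      {ω | ENNReal.ofReal (ε ^ (-α * γ)) ≤ X ω ^ γ} := by
    intro ω hω
    have h := ENNReal.rpow_le_rpow (le_of_lt hω) hγ.le
    rwa [ENNReal.ofReal_rpow_of_pos (Real.rpow_pos_of_pos hε _), ← Real.rpow_mul hε.le] at h
  have hone : ENNReal.ofReal (ε ^ (α * γ)) * ENNReal.ofReal (ε ^ (-α * γ)) = 1 := by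
    rw [← ENNReal.ofReal_mul (Real.rpow_nonneg hε.le _), ← Real.rpow_add hε]
    simp
  calc μ {ω | ENNReal.ofReal (ε ^ (-α)) < X ω}
      ≤ μ {ω | ENNReal.ofReal (ε ^ (-α * γ)) ≤ X ω ^ γ} := measure_mono hsub
    _ = ENNReal.ofReal (ε ^ (α * γ)) * (ENNReal.ofReal (ε ^ (-α * γ)) *
          μ {ω | ENNReal.ofReal (ε ^ (-α * γ)) ≤ X ω ^ γ}) := by
        rw [← mul_assoc, hone, one_mul]
    _ ≤ _ := by gcongr

/-- A supremum over `[0, u]` exceeding `c` exceeds it on a unit interval `[k, k + 1]` with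
`k ≤ ⌊u⌋₊`. -/
theorem exists_lt_iSup_Icc_natCast {f : ℝ → ℝ≥0∞} {c : ℝ≥0∞} {u : ℝ}
    (h : c < ⨆ t ∈ Set.Icc (0 : ℝ) u, f t) :
    ∃ k ∈ Finset.range (⌊u⌋₊ + 1), c < ⨆ t ∈ Set.Icc (k : ℝ) ((k : ℝ) + 1), f t := by
  obtain ⟨t, ht, hct⟩ := lt_biSup_iff.1 h
  exact ⟨⌊t⌋₊, Finset.mem_range.2 (Nat.lt_succ_of_le (Nat.floor_mono ht.2)),
    lt_biSup_iff.2 ⟨t, ⟨Nat.floor_le ht.1, (Nat.lt_floor_add_one t).le⟩, hct⟩⟩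

/-- A power of order `p > 2` absorbs the blow-up of `T / ε ^ 2` as `ε → 0⁺`. -/
theorem tendsto_div_sq_add_one_mul_rpow_nhdsGT_zero {p : ℝ} (hp : 2 < p) (T : ℝ) :
    Tendsto (fun ε : ℝ => (T / ε ^ 2 + 1) * ε ^ p) (nhdsWithin 0 (Set.Ioi 0)) (nhds 0) := by
  have hpow {q : ℝ} (hq : 0 < q) :
      Tendsto (fun ε : ℝ => ε ^ q) (nhdsWithin 0 (Set.Ioi 0)) (nhds 0) := by
    have h := (Real.continuousAt_rpow_const 0 q (Or.inr hq.le)).tendsto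
    rw [Real.zero_rpow hq.ne'] at h
    exact h.mono_left nhdsWithin_le_nhds
  have h := ((hpow (sub_pos.2 hp)).const_mul T).add (hpow (by linarith : 0 < p))
  rw [mul_zero, zero_add] at h
  refine h.congr' ?_
  filter_upwards [self_mem_nhdsWithin] with ε hε
  have hε' : (0 : ℝ) < ε := hε
  rw [Real.rpow_sub hε', Real.rpow_two]
  ring

/-- For a process `m̄` whose unit-interval suprema
`S_k = sup_{t ∈ [k,k+1]} ‖m̄(t)‖` are identically distributed with a finite moment of
order `γ > 0`, and for `α > 2/γ`, `T > 0`, the probability that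
`sup_{t ∈ [0, T/ε²]} ‖m̄(t)‖ > ε^{-α}` tends to `0` as `ε → 0⁺`. -/
theorem stmt7
    {Ω : Type*} [MeasurableSpace Ω] (ℙ : Measure Ω) [IsProbabilityMeasure ℙ]
    {E : Type*} [NormedAddCommGroup E]
    (mbar : ℝ → Ω → E)
    (hsupmeas : ∀ u : ℝ, 0 ≤ u →
      Measurable (fun ω => ⨆ t ∈ Set.Icc (0:ℝ) u, (‖mbar t ω‖₊ : ℝ≥0∞)))
    (S : ℕ → Ω → ℝ≥0∞)
    (hSdef : ∀ k ω, S k ω = ⨆ t ∈ Set.Icc (k : ℝ) ((k : ℝ) + 1), (‖mbar t ω‖₊ : ℝ≥0∞))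
    (hSmeas : ∀ k, Measurable (S k))
    (hSid : ∀ k, Measure.map (S k) ℙ = Measure.map (S 0) ℙ)
    (γ : ℝ) (hγ : 0 < γ)
    (hmom : ∫⁻ ω, S 0 ω ^ γ ∂ℙ < ⊤)
    (α : ℝ) (hα : 2 / γ < α) (T : ℝ) (hT : 0 < T) :
    Tendsto
      (fun ε : ℝ => ℙ {ω | ENNReal.ofReal (ε ^ (-α)) <
        ⨆ t ∈ Set.Icc (0:ℝ) (T / ε ^ 2), (‖mbar t ω‖₊ : ℝ≥0∞)})
      (nhdsWithin 0 (Set.Ioi 0)) (nhds 0) := by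
  have hp : 2 < α * γ := (div_lt_iff₀ hγ).1 hα
  set M := ∫⁻ ω, S 0 ω ^ γ ∂ℙ
  have hlim : Tendsto (fun ε : ℝ => ENNReal.ofReal ((T / ε ^ 2 + 1) * ε ^ (α * γ)) * M)
      (nhdsWithin 0 (Set.Ioi 0)) (nhds 0) := by
    have h := ENNReal.Tendsto.mul_const
      (ENNReal.tendsto_ofReal (tendsto_div_sq_add_one_mul_rpow_nhdsGT_zero hp T))
      (Or.inr hmom.ne : ENNReal.ofReal 0 ≠ 0 ∨ M ≠ ⊤)
    simpa using h
  refine tendsto_of_tendsto_of_tendsto_of_le_of_le' tendsto_const_nhds hlim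
    (Eventually.of_forall fun _ => zero_le) ?_
  filter_upwards [self_mem_nhdsWithin] with ε hε
  have hε' : (0 : ℝ) < ε := hε
  set c := ENNReal.ofReal (ε ^ (-α))
  have htail (k : ℕ) : ℙ {ω | c < S k ω} ≤ ENNReal.ofReal (ε ^ (α * γ)) * M := by
    have hk : ℙ {ω | c < S k ω} = ℙ {ω | c < S 0 ω} := by
      have h := congrArg (fun ν => ν (Set.Ioi c)) (hSid k)
      simp only [Measure.map_apply (hSmeas _) measurableSet_Ioi] at h
      exact h
    rw [hk]
    exact measure_ofReal_rpow_neg_lt_le ℙ (hSmeas 0) hγ α hε'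
  have hT' : 0 ≤ T / ε ^ 2 := by positivity
  calc ℙ {ω | c < ⨆ t ∈ Set.Icc (0 : ℝ) (T / ε ^ 2), (‖mbar t ω‖₊ : ℝ≥0∞)}
      ≤ ℙ (⋃ k ∈ Finset.range (⌊T / ε ^ 2⌋₊ + 1), {ω | c < S k ω}) := by
        refine measure_mono fun ω hω => ?_
        obtain ⟨k, hk, hck⟩ := exists_lt_iSup_Icc_natCast hω
        exact Set.mem_biUnion hk (show c < S k ω by rwa [hSdef])
    _ ≤ ∑ k ∈ Finset.range (⌊T / ε ^ 2⌋₊ + 1), ℙ {ω | c < S k ω} :=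
        measure_biUnion_finset_le _ _
    _ ≤ ∑ _k ∈ Finset.range (⌊T / ε ^ 2⌋₊ + 1), ENNReal.ofReal (ε ^ (α * γ)) * M :=
        Finset.sum_le_sum fun k _ => htail k
    _ = ENNReal.ofReal ((⌊T / ε ^ 2⌋₊ : ℝ) + 1) * (ENNReal.ofReal (ε ^ (α * γ)) * M) := by
        rw [Finset.sum_const, Finset.card_range, nsmul_eq_mul, ← Nat.cast_succ,
          ENNReal.ofReal_natCast]
    _ ≤ ENNReal.ofReal (T / ε ^ 2 + 1) * (ENNReal.ofReal (ε ^ (α * γ)) * M) := by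
        gcongr
        exact Nat.floor_le hT'
    _ = ENNReal.ofReal ((T / ε ^ 2 + 1) * ε ^ (α * γ)) * M := by
        rw [ENNReal.ofReal_mul (by positivity), mul_assoc]
end

section
/- Let F be a real Banach space, T > 0 and f₀ ∈ F. Let S : [0,T] → (F →L F) be a family of continuous linear operators with ‖S(t)f‖ ≤ ‖f‖ for all t ∈ [0,T] and f ∈ F, and let G : [0,T] → (F →L F) satisfy M := sup_{t ∈ [0,T]} ‖G(t)‖_op < ∞. Assume that for every continuous f : [0,T] → F and every t ∈ [0,T], the map s ↦ S(t−s)(G(s)(f(s))) is Bochner integrable on [0,t], and the map t ↦ S(t)f₀ + ∫₀^t S(t−s)(G(s)(f(s))) ds is continuous on [0,T]. Then there exists a unique continuous function f : [0,T] → F such that f(t) = S(t)f₀ + ∫₀^t S(t−s)(G(s)(f(s))) ds for all t ∈ [0,T]. -/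
open MeasureTheory

open Set Function in
/-- A self-map of `C([0,T], F)` satisfying a Volterra-type Lipschitz bound satisfies the
factorial Picard estimate after `n` iterations. -/
theorem norm_iterate_sub_le_of_volterra {F : Type*} [NormedAddCommGroup F]
    {T : ℝ} (hT : 0 ≤ T) {M : ℝ} (hM : 0 ≤ M) {Φ : C(Icc (0 : ℝ) T, F) → C(Icc (0 : ℝ) T, F)}
    (hΦ : ∀ f g (t : Icc (0 : ℝ) T),
      ‖Φ f t - Φ g t‖ ≤ M * ∫ s in (0 : ℝ)..t, ‖IccExtend hT f s - IccExtend hT g s‖)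
    (f g : C(Icc (0 : ℝ) T, F)) (n : ℕ) (t : Icc (0 : ℝ) T) :
    ‖Φ^[n] f t - Φ^[n] g t‖ ≤ (M * t) ^ n / n.factorial * dist f g := by
  induction n generalizing t with
  | zero => simpa [dist_eq_norm] using ContinuousMap.dist_apply_le_dist (f := f) (g := g) t
  | succ n ih =>
    rw [iterate_succ_apply', iterate_succ_apply']
    refine (hΦ _ _ t).trans ?_
    have hcont : ∀ u : C(Icc (0 : ℝ) T, F), Continuous (IccExtend hT u) :=
      fun u => u.continuous.Icc_extend'
    calc
      M * ∫ s in (0 : ℝ)..t, ‖IccExtend hT (Φ^[n] f) s - IccExtend hT (Φ^[n] g) s‖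
        ≤ M * ∫ s in (0 : ℝ)..t, M ^ n / n.factorial * dist f g * s ^ n := by
          refine mul_le_mul_of_nonneg_left ?_ hM
          refine intervalIntegral.integral_mono_on t.2.1
            ((hcont _).sub (hcont _)).norm.continuousOn.intervalIntegrable
            (by fun_prop : Continuous _).continuousOn.intervalIntegrable fun s hs => ?_
          have hsT : s ∈ Icc (0 : ℝ) T := ⟨hs.1, hs.2.trans t.2.2⟩
          rw [IccExtend_of_mem _ _ hsT, IccExtend_of_mem _ _ hsT]
          refine (ih ⟨s, hsT⟩).trans_eq ?_
          simp only [mul_pow]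
          ring
      _ = (M * t) ^ (n + 1) / (n + 1).factorial * dist f g := by
          rw [intervalIntegral.integral_const_mul, integral_pow, Nat.factorial_succ]
          push_cast
          field_simp
          simp only [ne_eq, Nat.add_eq_zero_iff, one_ne_zero, and_false, not_false_eq_true,
            zero_pow, sub_zero]
          ring

open Set in
/-- A self-map of `C([0,T], F)` satisfying a Volterra-type Lipschitz bound has a contracting
iterate. -/
theorem exists_contractingWith_iterate_of_volterra {F : Type*} [NormedAddCommGroup F]
    {T : ℝ} (hT : 0 ≤ T) {M : ℝ} (hM : 0 ≤ M) {Φ : C(Icc (0 : ℝ) T, F) → C(Icc (0 : ℝ) T, F)}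
    (hΦ : ∀ f g (t : Icc (0 : ℝ) T),
      ‖Φ f t - Φ g t‖ ≤ M * ∫ s in (0 : ℝ)..t, ‖IccExtend hT f s - IccExtend hT g s‖) :
    ∃ n K, ContractingWith K Φ^[n] := by
  obtain ⟨n, hn⟩ := ((FloorSemiring.tendsto_pow_div_factorial_atTop (M * T)).eventually
    (gt_mem_nhds zero_lt_one)).exists
  have h0 : 0 ≤ (M * T) ^ n / n.factorial := by positivity
  refine ⟨n, ⟨(M * T) ^ n / n.factorial, h0⟩, by exact_mod_cast hn, ?_⟩
  refine LipschitzWith.of_dist_le_mul fun f g => ?_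
  refine (ContinuousMap.dist_le (mul_nonneg h0 dist_nonneg)).2 fun t => ?_
  rw [dist_eq_norm]
  refine (norm_iterate_sub_le_of_volterra hT hM hΦ f g n t).trans ?_
  have ht := t.2
  change _ ≤ (M * T) ^ n / n.factorial * dist f g
  have := mul_nonneg hM ht.1
  gcongr
  exact ht.2

open Set Function in
/-- A self-map of `C([0,T], F)` satisfying a Volterra-type Lipschitz bound has a unique
fixed point. -/
theorem existsUnique_isFixedPt_of_volterra {F : Type*} [NormedAddCommGroup F] [CompleteSpace F]
    {T : ℝ} (hT : 0 ≤ T) {M : ℝ} (hM : 0 ≤ M) {Φ : C(Icc (0 : ℝ) T, F) → C(Icc (0 : ℝ) T, F)}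
    (hΦ : ∀ f g (t : Icc (0 : ℝ) T),
      ‖Φ f t - Φ g t‖ ≤ M * ∫ s in (0 : ℝ)..t, ‖IccExtend hT f s - IccExtend hT g s‖) :
    ∃! f, IsFixedPt Φ f := by
  obtain ⟨n, K, hK⟩ := exists_contractingWith_iterate_of_volterra hT hM hΦ
  exact ⟨_, hK.isFixedPt_fixedPoint_iterate, fun f hf => hK.fixedPoint_unique (hf.iterate n)⟩

/-- Existence and uniqueness of the continuous mild solution
`f(t) = S(t)f₀ + ∫₀^t S(t−s)(G(s)(f(s))) ds` on `[0,T]`, where the semigroup-like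
family `S` consists of contractions and `G` is a uniformly bounded family of
continuous linear operators. -/
theorem stmt8
    {F : Type*} [NormedAddCommGroup F] [NormedSpace ℝ F] [CompleteSpace F]
    (T : ℝ) (hT : 0 < T) (f₀ : F)
    (S : ℝ → F →L[ℝ] F)
    (hS : ∀ t ∈ Set.Icc (0:ℝ) T, ∀ f : F, ‖S t f‖ ≤ ‖f‖)
    (G : ℝ → F →L[ℝ] F)
    (M : ℝ) (hM : ∀ t ∈ Set.Icc (0:ℝ) T, ‖G t‖ ≤ M)
    (hInt : ∀ f : ℝ → F, ContinuousOn f (Set.Icc 0 T) → ∀ t ∈ Set.Icc (0:ℝ) T,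
      IntegrableOn (fun s => S (t - s) (G s (f s))) (Set.Icc 0 t) volume)
    (hCont : ∀ f : ℝ → F, ContinuousOn f (Set.Icc 0 T) →
      ContinuousOn (fun t => S t f₀ + ∫ s in Set.Icc (0:ℝ) t, S (t - s) (G s (f s)))
        (Set.Icc 0 T)) :
    (∃ f : ℝ → F, ContinuousOn f (Set.Icc 0 T) ∧
      ∀ t ∈ Set.Icc (0:ℝ) T,
        f t = S t f₀ + ∫ s in Set.Icc (0:ℝ) t, S (t - s) (G s (f s))) ∧
    (∀ f g : ℝ → F, ContinuousOn f (Set.Icc 0 T) → ContinuousOn g (Set.Icc 0 T) →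
      (∀ t ∈ Set.Icc (0:ℝ) T,
        f t = S t f₀ + ∫ s in Set.Icc (0:ℝ) t, S (t - s) (G s (f s))) →
      (∀ t ∈ Set.Icc (0:ℝ) T,
        g t = S t f₀ + ∫ s in Set.Icc (0:ℝ) t, S (t - s) (G s (g s))) →
      ∀ t ∈ Set.Icc (0:ℝ) T, f t = g t) := by
  have hM0 : 0 ≤ M := (norm_nonneg _).trans (hM 0 ⟨le_rfl, hT.le⟩)
  have hExt : ∀ u : C(Set.Icc (0 : ℝ) T, F), ContinuousOn (Set.IccExtend hT.le u) (Set.Icc 0 T) :=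
    fun u => u.continuous.Icc_extend'.continuousOn
  let Φ : C(Set.Icc (0 : ℝ) T, F) → C(Set.Icc (0 : ℝ) T, F) := fun u =>
    ⟨_, (hCont _ (hExt u)).domRestrict⟩
  have hΦ_apply : ∀ u t, Φ u t = S t f₀ +
      ∫ s in Set.Icc (0 : ℝ) t, S (t - s) (G s (Set.IccExtend hT.le u s)) := fun _ _ => rfl
  have hΦ : ∀ u v (t : Set.Icc (0 : ℝ) T), ‖Φ u t - Φ v t‖ ≤
      M * ∫ s in (0 : ℝ)..t, ‖Set.IccExtend hT.le u s - Set.IccExtend hT.le v s‖ := by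
    intro u v t
    rw [hΦ_apply, hΦ_apply, add_sub_add_left_eq_sub,
      ← integral_sub (hInt _ (hExt u) t t.2) (hInt _ (hExt v) t t.2),
      intervalIntegral.integral_of_le t.2.1, ← integral_Icc_eq_integral_Ioc,
      ← integral_const_mul]
    refine norm_integral_le_of_norm_le ?_ ?_
    · exact ((continuous_const.mul
        (u.continuous.Icc_extend'.sub v.continuous.Icc_extend').norm).continuousOn).integrableOn_Icc
    · filter_upwards [ae_restrict_mem measurableSet_Icc] with s hs
      have hsT : s ∈ Set.Icc (0 : ℝ) T := ⟨hs.1, hs.2.trans t.2.2⟩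
      rw [← map_sub, ← map_sub]
      exact (hS _ ⟨sub_nonneg.2 hs.2, (sub_le_self _ hs.1).trans t.2.2⟩ _).trans
        ((G s).le_of_opNorm_le (hM s hsT) _)
  obtain ⟨u, hu, huniq⟩ := existsUnique_isFixedPt_of_volterra hT.le hM0 hΦ
  refine ⟨⟨Set.IccExtend hT.le u, hExt u, fun t ht => ?_⟩, fun f g hf hg hfe hge => ?_⟩
  · rw [Set.IccExtend_of_mem _ _ ht, ← hΦ_apply u ⟨t, ht⟩, hu.eq]
  · have hfix : ∀ f : ℝ → F, ∀ hf : ContinuousOn f (Set.Icc 0 T),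
        (∀ t ∈ Set.Icc (0 : ℝ) T,
          f t = S t f₀ + ∫ s in Set.Icc (0 : ℝ) t, S (t - s) (G s (f s))) →
        (⟨_, hf.domRestrict⟩ : C(Set.Icc (0 : ℝ) T, F)) = u := by
      intro f hf hfe
      refine huniq _ (ContinuousMap.ext fun t => ?_)
      rw [hΦ_apply]
      refine Eq.trans ?_ (hfe t t.2).symm
      congr 1
      refine setIntegral_congr_fun measurableSet_Icc fun s hs => ?_
      have hsT : s ∈ Set.Icc (0 : ℝ) T := ⟨hs.1, hs.2.trans t.2.2⟩
      simp [Set.IccExtend_of_mem _ _ hsT]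
    intro t ht
    exact DFunLike.congr_fun ((hfix f hf hfe).trans (hfix g hg hge).symm) ⟨t, ht⟩
end

section
/- Let X be a real normed vector space, T > 0 and Λ > 0. For z ∈ C([0,T], X) and Λ' > 0 define τ_{Λ'}(z) := inf { t ∈ [0,T] : ‖z(t)‖ ≥ Λ' } ∈ [0,∞] (with inf ∅ = ∞). Fix z ∈ C([0,T], X) and assume that the nondecreasing map Λ' ↦ τ_{Λ'}(z), from (0,∞) to [0,∞], is continuous at Λ. Then the map z' ↦ τ_Λ(z'), from C([0,T], X) (with the uniform metric) to [0,∞], is continuous at z. -/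
open scoped ENNReal

/-- The hitting time of the level `Λ` by the norm of a continuous path
`z ∈ C([0,T], X)`, with values in `[0,∞]` (`∞` if the level is never reached). -/
noncomputable def hitTime {X : Type*} [NormedAddCommGroup X] (T Λ : ℝ)
    (z : C(Set.Icc (0:ℝ) T, X)) : ℝ≥0∞ :=
  ⨅ (t : Set.Icc (0:ℝ) T) (_ : Λ ≤ ‖z t‖), ENNReal.ofReal (t : ℝ)

theorem hitTime_add_dist_le {X : Type*} [NormedAddCommGroup X] (T Λ : ℝ)
    (z w : C(Set.Icc (0:ℝ) T, X)) : hitTime T Λ z ≤ hitTime T (Λ + dist z w) w := by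
  refine le_iInf₂ fun t ht => iInf₂_le t ?_
  have hdist : dist (z t) (w t) ≤ dist z w := ContinuousMap.dist_apply_le_dist t
  have hnorm : ‖w t‖ - ‖z t‖ ≤ dist (z t) (w t) := by
    rw [dist_comm, dist_eq_norm]
    exact norm_sub_norm_le _ _
  linarith

theorem hitTime_sub_dist_le {X : Type*} [NormedAddCommGroup X] (T Λ : ℝ)
    (z w : C(Set.Icc (0:ℝ) T, X)) : hitTime T (Λ - dist z w) w ≤ hitTime T Λ z := by
  simpa [dist_comm w z] using hitTime_add_dist_le T (Λ - dist z w) w z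

/-- If the nondecreasing map `Λ' ↦ τ_{Λ'}(z)` (from `(0,∞)` to
`[0,∞]`) is continuous at `Λ`, then the hitting time `z' ↦ τ_Λ(z')` is continuous
at `z` for the uniform metric on `C([0,T], X)`. -/
theorem stmt12
    {X : Type*} [NormedAddCommGroup X] (T Λ : ℝ) (hT : 0 < T) (hΛ : 0 < Λ)
    (z : C(Set.Icc (0:ℝ) T, X))
    (hcont : ContinuousWithinAt (fun Λ' : ℝ => hitTime T Λ' z) (Set.Ioi 0) Λ) :
    ContinuousAt (fun z' : C(Set.Icc (0:ℝ) T, X) => hitTime T Λ z') z := by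
  have hlevel : ContinuousAt (fun Λ' : ℝ => hitTime T Λ' z) Λ :=
    hcont.continuousAt (Ioi_mem_nhds hΛ)
  have hdist : Filter.Tendsto (fun z' => dist z' z) (nhds z) (nhds 0) :=
    tendsto_iff_dist_tendsto_zero.mp Filter.tendsto_id
  have hsub : Filter.Tendsto (fun z' => Λ - dist z' z) (nhds z) (nhds Λ) := by
    simpa using hdist.const_sub Λ
  have hadd : Filter.Tendsto (fun z' => Λ + dist z' z) (nhds z) (nhds Λ) := by
    simpa using hdist.const_add Λ
  exact tendsto_of_tendsto_of_tendsto_of_le_of_le (hlevel.tendsto.comp hsub)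
    (hlevel.tendsto.comp hadd) (fun z' => hitTime_sub_dist_le T Λ z' z)
    (fun z' => hitTime_add_dist_le T Λ z' z)
end

section
/- Let X be a real normed vector space, T > 0 and Λ > 0. For z ∈ C([0,T], X) define the capped hitting time σ_Λ(z) := inf ( { t ∈ [0,T] : ‖z(t)‖ ≥ Λ } ∪ {T} ) ∈ [0,T], and the stopped path S_Λ(z) ∈ C([0,T], X) by S_Λ(z)(t) := z(min(t, σ_Λ(z))). Fix z ∈ C([0,T], X) and assume that the map z' ↦ σ_Λ(z') from C([0,T], X) (with the uniform metric) to ℝ is continuous at z. Then the map S_Λ : C([0,T], X) → C([0,T], X) is continuous at z (both copies of C([0,T], X) carrying the uniform metric). -/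
/-- The capped hitting time `σ_Λ(z) = inf({t ∈ [0,T] : ‖z(t)‖ ≥ Λ} ∪ {T}) ∈ [0,T]`. -/
noncomputable def capTime {X : Type*} [NormedAddCommGroup X] (T Λ : ℝ)
    (z : C(Set.Icc (0:ℝ) T, X)) : ℝ :=
  sInf ({t : ℝ | ∃ s : Set.Icc (0:ℝ) T, Λ ≤ ‖z s‖ ∧ t = (s : ℝ)} ∪ {T})

theorem capTime_nonneg {X : Type*} [NormedAddCommGroup X] {T : ℝ} (Λ : ℝ)
    (hT : 0 ≤ T) (z : C(Set.Icc (0:ℝ) T, X)) : 0 ≤ capTime T Λ z := by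
  apply Real.sInf_nonneg
  rintro x (⟨s, -, rfl⟩ | rfl)
  · exact s.2.1
  · exact hT

theorem capTime_le {X : Type*} [NormedAddCommGroup X] {T : ℝ} (Λ : ℝ)
    (hT : 0 ≤ T) (z : C(Set.Icc (0:ℝ) T, X)) : capTime T Λ z ≤ T := by
  apply csInf_le
  · refine ⟨0, ?_⟩
    rintro x (⟨s, -, rfl⟩ | rfl)
    · exact s.2.1
    · exact hT
  · exact Set.mem_union_right _ rfl

/-- The path `z` stopped at the capped hitting time `σ_Λ(z)`:
`S_Λ(z)(t) = z(min(t, σ_Λ(z)))`. -/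
noncomputable def stopAt {X : Type*} [NormedAddCommGroup X] (T Λ : ℝ) (hT : 0 ≤ T)
    (z : C(Set.Icc (0:ℝ) T, X)) : C(Set.Icc (0:ℝ) T, X) where
  toFun t := z ⟨min (t : ℝ) (capTime T Λ z),
    le_min t.2.1 (capTime_nonneg Λ hT z), min_le_of_left_le t.2.2⟩
  continuous_toFun :=
    z.continuous.comp <|
      Continuous.subtype_mk (continuous_subtype_val.min continuous_const) _

/-- If the capped hitting time `σ_Λ : C([0,T], X) → ℝ` is continuous
at `z`, then the stopping map `S_Λ : C([0,T], X) → C([0,T], X)` is continuous at `z`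
(uniform metric on both sides). -/
theorem stmt14
    {X : Type*} [NormedAddCommGroup X] (T Λ : ℝ) (hT : 0 < T) (hΛ : 0 < Λ)
    (z : C(Set.Icc (0:ℝ) T, X))
    (hcont : ContinuousAt (fun z' : C(Set.Icc (0:ℝ) T, X) => capTime T Λ z') z) :
    ContinuousAt (stopAt T Λ hT.le) z := by
  rw [Metric.continuousAt_iff'] at hcont ⊢
  intro ε hε
  obtain ⟨δ, hδ, hz⟩ := Metric.uniformContinuous_iff.1
    (CompactSpace.uniformContinuous_of_continuous z.continuous) (ε / 4) (by positivity)
  filter_upwards [hcont δ hδ, Metric.ball_mem_nhds z (show 0 < ε / 4 by positivity)]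
    with w hσ hw
  have hle : dist (stopAt T Λ hT.le w) (stopAt T Λ hT.le z) ≤ ε / 2 := by
    refine (ContinuousMap.dist_le (by positivity)).2 fun t => ?_
    have hw_unif := (ContinuousMap.dist_apply_le_dist (f := w) (g := z)
      ⟨min (t : ℝ) (capTime T Λ w),
        le_min t.2.1 (capTime_nonneg Λ hT.le w), min_le_of_left_le t.2.2⟩).trans_lt hw
    have hz_close : dist (z ⟨min (t : ℝ) (capTime T Λ w),
          le_min t.2.1 (capTime_nonneg Λ hT.le w), min_le_of_left_le t.2.2⟩)
        (z ⟨min (t : ℝ) (capTime T Λ z),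
          le_min t.2.1 (capTime_nonneg Λ hT.le z), min_le_of_left_le t.2.2⟩) < ε / 4 := by
      refine hz (lt_of_le_of_lt ?_ hσ)
      rw [Subtype.dist_eq, Real.dist_eq, Real.dist_eq]
      exact (abs_min_sub_min_le_max _ _ _ _).trans (by simp)
    exact (dist_triangle _ _ _).trans
      ((add_le_add hw_unif.le hz_close.le).trans_eq (by ring))
  linarith
end

section
/- Let (Ω, 𝓕, ℙ) be a probability space, T ≥ 0, δ ≥ 0, and let τ₁, τ₂ : Ω → ℝ be measurable functions with 0 ≤ τ₁(ω) ≤ τ₂(ω) ≤ τ₁(ω) + δ for ℙ-almost every ω. Then ∫₀^T ( ℙ({ω : τ₁(ω) ≤ s and s ≤ τ₂(ω)}) )^{1/2} ds ≤ √(T · δ). -/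
open MeasureTheory

theorem measurableSet_mem_Icc_random
    {Ω : Type*} [MeasurableSpace Ω] {τ₁ τ₂ : Ω → ℝ} (h₁ : Measurable τ₁) (h₂ : Measurable τ₂) :
    MeasurableSet {p : ℝ × Ω | τ₁ p.2 ≤ p.1 ∧ p.1 ≤ τ₂ p.2} :=
  (measurableSet_le (h₁.comp measurable_snd) measurable_fst).inter
    (measurableSet_le measurable_fst (h₂.comp measurable_snd))

/-- The Lebesgue integral of the probability that `s` lies in a random interval is the expected
length of that interval. -/
theorem lintegral_measure_mem_Icc_random
    {Ω : Type*} [MeasurableSpace Ω] (ℙ : Measure Ω) [SFinite ℙ]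
    {τ₁ τ₂ : Ω → ℝ} (h₁ : Measurable τ₁) (h₂ : Measurable τ₂) :
    ∫⁻ s, ℙ {ω | τ₁ ω ≤ s ∧ s ≤ τ₂ ω} = ∫⁻ ω, ENNReal.ofReal (τ₂ ω - τ₁ ω) ∂ℙ := by
  have hS := measurableSet_mem_Icc_random h₁ h₂
  calc ∫⁻ s, ℙ {ω | τ₁ ω ≤ s ∧ s ≤ τ₂ ω}
      = (volume.prod ℙ) {p : ℝ × Ω | τ₁ p.2 ≤ p.1 ∧ p.1 ≤ τ₂ p.2} :=
        (Measure.prod_apply hS).symm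
    _ = ∫⁻ ω, volume (Set.Icc (τ₁ ω) (τ₂ ω)) ∂ℙ := Measure.prod_apply_symm hS
    _ = _ := by simp only [Real.volume_Icc]

/-- Cauchy–Schwarz for the integral of a square root over `[0, T]`. -/
theorem intervalIntegral_sqrt_le_sqrt_mul {T δ : ℝ} (hT : 0 ≤ T) {g : ℝ → ℝ} (hg : ∀ s, 0 ≤ g s)
    (hgi : IntervalIntegrable g volume 0 T)
    (hsi : IntervalIntegrable (fun s => √(g s)) volume 0 T)
    (hδ : ∫ s in (0:ℝ)..T, g s ≤ δ) :
    ∫ s in (0:ℝ)..T, √(g s) ≤ √(T * δ) := by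
  rcases hT.eq_or_lt with rfl | hT'
  · simp
  set I := ∫ s in (0:ℝ)..T, √(g s) with hI
  have key : ∫ s in (0:ℝ)..T, 2 * (I / T) * √(g s) ≤ ∫ s in (0:ℝ)..T, (g s + (I / T) ^ 2) := by
    refine intervalIntegral.integral_mono_on hT (hsi.const_mul _)
      (hgi.add intervalIntegrable_const) fun s _ => ?_
    nlinarith [sq_nonneg (√(g s) - I / T), Real.sq_sqrt (hg s)]
  rw [intervalIntegral.integral_const_mul, ← hI,
    intervalIntegral.integral_add hgi intervalIntegrable_const,
    intervalIntegral.integral_const, smul_eq_mul, sub_zero] at key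
  refine Real.le_sqrt_of_sq_le ?_
  have h : I ^ 2 / T ≤ δ := by
    have e₁ : 2 * (I / T) * I = 2 * (I ^ 2 / T) := by ring
    have e₂ : T * (I / T) ^ 2 = I ^ 2 / T := by field_simp
    linarith
  rw [div_le_iff₀ hT'] at h
  linarith

/-- If `0 ≤ τ₁ ≤ τ₂ ≤ τ₁ + δ` almost surely, then
`∫₀^T √(ℙ(τ₁ ≤ s ≤ τ₂)) ds ≤ √(T · δ)`. -/
theorem stmt16
    {Ω : Type*} [MeasurableSpace Ω] (ℙ : Measure Ω) [IsProbabilityMeasure ℙ]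
    (T δ : ℝ) (hT : 0 ≤ T) (hδ : 0 ≤ δ)
    (τ₁ τ₂ : Ω → ℝ) (h₁ : Measurable τ₁) (h₂ : Measurable τ₂)
    (hord : ∀ᵐ ω ∂ℙ, 0 ≤ τ₁ ω ∧ τ₁ ω ≤ τ₂ ω ∧ τ₂ ω ≤ τ₁ ω + δ) :
    ∫ s in (0:ℝ)..T, Real.sqrt ((ℙ {ω | τ₁ ω ≤ s ∧ s ≤ τ₂ ω}).toReal) ≤
      Real.sqrt (T * δ) := by
  have hm : Measurable fun s : ℝ => ℙ {ω | τ₁ ω ≤ s ∧ s ≤ τ₂ ω} :=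
    measurable_measure_prodMk_left (measurableSet_mem_Icc_random h₁ h₂)
  have hle : ∀ s : ℝ, (ℙ {ω | τ₁ ω ≤ s ∧ s ≤ τ₂ ω}).toReal ≤ 1 := fun s =>
    measureReal_le_one
  have integrable_of_le_one : ∀ f : ℝ → ℝ, Measurable f → (∀ s, 0 ≤ f s) → (∀ s, f s ≤ 1) →
      IntervalIntegrable f volume 0 T := fun f hf h0 h1 =>
    (intervalIntegrable_const (c := (1 : ℝ))).mono_fun hf.aestronglyMeasurable
      (Filter.Eventually.of_forall fun s => by simpa [abs_of_nonneg (h0 s)] using h1 s)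
  refine intervalIntegral_sqrt_le_sqrt_mul hT (fun _ => ENNReal.toReal_nonneg)
    (integrable_of_le_one _ hm.ennreal_toReal (fun _ => ENNReal.toReal_nonneg) hle)
    (integrable_of_le_one _ hm.ennreal_toReal.sqrt (fun _ => Real.sqrt_nonneg _)
      fun s => Real.sqrt_le_one.mpr (hle s)) ?_
  rw [intervalIntegral.integral_of_le hT, integral_toReal hm.aemeasurable
    (Filter.Eventually.of_forall fun s => measure_lt_top _ _)]
  refine ENNReal.toReal_le_of_le_ofReal hδ ?_
  calc ∫⁻ s in Set.Ioc 0 T, ℙ {ω | τ₁ ω ≤ s ∧ s ≤ τ₂ ω}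
      ≤ ∫⁻ s, ℙ {ω | τ₁ ω ≤ s ∧ s ≤ τ₂ ω} := setLIntegral_le_lintegral _ _
    _ = ∫⁻ ω, ENNReal.ofReal (τ₂ ω - τ₁ ω) ∂ℙ := lintegral_measure_mem_Icc_random ℙ h₁ h₂
    _ ≤ ∫⁻ _, ENNReal.ofReal δ ∂ℙ := by
        refine lintegral_mono_ae (hord.mono fun ω h => ENNReal.ofReal_le_ofReal ?_)
        linarith [h.2.2]
    _ = ENNReal.ofReal δ := by simp
end
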